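/- arXiv:2311.15049 — 3 statements merged into one kernel-verified Lean document; each statement's English description precedes it below -/
import Mathlib

section
/- For an Archimedean vector lattice F, the following are equivalent: (i) F is Dedekind complete (every nonempty subset of F bounded above has a supremum in F) and atomic (every g > 0 dominates an atom); (ii) every order interval [u,v] in F is order compact (every ultrafilter on F containing [u,v] order converges to some element of [u,v]); (iii) F is order locally compact (every filter on F that order converges to some element of F contains an order compact subset of F). -/
/-- A filter `G` on a lattice order converges to `p` if it contains a family of
order intervals whose intersection equals `{p}`. -/
def OrderConvergesTo {F : Type*} [Lattice F] (G : Filter F) (p : F) : Prop :=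
  ∃ S : Set (F × F),
    (∀ q ∈ S, q.1 ≤ q.2) ∧
    (∀ q ∈ S, Set.Icc q.1 q.2 ∈ G) ∧
    (⋂ q ∈ S, Set.Icc q.1 q.2) = {p}

/-- A filter `G` is order Cauchy if the pushforward of `G ×ˢ G` under `(x, y) ↦ x - y`
order converges to `0`. -/
def OrderCauchy {F : Type*} [Lattice F] [AddCommGroup F] (G : Filter F) : Prop :=
  OrderConvergesTo (Filter.map (fun q : F × F => q.1 - q.2) (G ×ˢ G)) (0 : F)

/-- A subset `S` is order pre-compact if every ultrafilter containing `S` is order Cauchy. -/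
def OrderPreCompact {F : Type*} [Lattice F] [AddCommGroup F] (S : Set F) : Prop :=
  ∀ U : Ultrafilter F, S ∈ U → OrderCauchy (U : Filter F)

/-- An atom of a vector lattice: a positive element all of whose order-subelements are
scalar multiples of it. -/
def IsVLAtom {F : Type*} [Lattice F] [AddCommGroup F] [Module ℝ F] (a : F) : Prop :=
  0 < a ∧ ∀ b : F, 0 ≤ b → b ≤ a → ∃ t : ℝ, b = t • a

/-- A subset `S` is order compact if every ultrafilter containing `S` order converges
to some element of `S`. -/
def OrderCompact {F : Type*} [Lattice F] (S : Set F) : Prop :=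
  ∀ U : Ultrafilter F, S ∈ U → ∃ p ∈ S, OrderConvergesTo (U : Filter F) p

section Lattice

variable {F : Type*} [Lattice F]

/-- An order limit of a proper filter lies below every upper bound of a member of the filter. -/
theorem OrderConvergesTo.le_of_Iic_mem {U : Filter F} [U.NeBot] {p b : F}
    (h : OrderConvergesTo U p) (hb : Set.Iic b ∈ U) : p ≤ b := by
  obtain ⟨S, -, hS, hp⟩ := h
  have hpS : p ∈ ⋂ q ∈ S, Set.Icc q.1 q.2 := by rw [hp]; rfl
  simp only [Set.mem_iInter] at hpS
  have : p ⊓ b ∈ ⋂ q ∈ S, Set.Icc q.1 q.2 := by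
    simp only [Set.mem_iInter]
    intro q hq
    obtain ⟨x, hx, hxb⟩ := Filter.nonempty_of_mem (Filter.inter_mem (hS q hq) hb)
    exact ⟨le_inf (hpS q hq).1 (hx.1.trans hxb), inf_le_left.trans (hpS q hq).2⟩
  rw [hp] at this
  exact inf_eq_left.1 this

/-- An order limit of a proper filter lies above every lower bound of a member of the filter. -/
theorem OrderConvergesTo.le_of_Ici_mem {U : Filter F} [U.NeBot] {p a : F}
    (h : OrderConvergesTo U p) (ha : Set.Ici a ∈ U) : a ≤ p := by
  obtain ⟨S, -, hS, hp⟩ := h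
  have hpS : p ∈ ⋂ q ∈ S, Set.Icc q.1 q.2 := by rw [hp]; rfl
  simp only [Set.mem_iInter] at hpS
  have : p ⊔ a ∈ ⋂ q ∈ S, Set.Icc q.1 q.2 := by
    simp only [Set.mem_iInter]
    intro q hq
    obtain ⟨x, hx, hxa⟩ := Filter.nonempty_of_mem (Filter.inter_mem (hS q hq) ha)
    exact ⟨(hpS q hq).1.trans le_sup_left, sup_le (hpS q hq).2 (le_trans hxa hx.2)⟩
  rw [hp] at this
  exact sup_eq_left.1 this

theorem OrderCompact.Icc_of_subset {S : Set F} (hS : OrderCompact S) {a b : F}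
    (hab : Set.Icc a b ⊆ S) : OrderCompact (Set.Icc a b) := by
  intro U hU
  obtain ⟨p, -, hp⟩ := hS U (Filter.mem_of_superset hU hab)
  exact ⟨p, ⟨hp.le_of_Ici_mem (Filter.mem_of_superset hU Set.Icc_subset_Ici_self),
    hp.le_of_Iic_mem (Filter.mem_of_superset hU Set.Icc_subset_Iic_self)⟩, hp⟩

theorem OrderConvergesTo.of_map_orderIso {F' : Type*} [Lattice F'] (e : F ≃o F') {G : Filter F}
    {p : F} (h : OrderConvergesTo (G.map e) (e p)) : OrderConvergesTo G p := by
  obtain ⟨S, hle, hS, hp⟩ := h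
  have hIcc (q : F × F) : e ⁻¹' Set.Icc (e q.1) (e q.2) = Set.Icc q.1 q.2 := by
    ext x; simp
  refine ⟨{q | (e q.1, e q.2) ∈ S}, fun q hq => e.le_iff_le.1 (hle _ hq), fun q hq => ?_, ?_⟩
  · rw [← hIcc]
    exact hS _ hq
  · ext x
    have : e x ∈ (⋂ q ∈ S, Set.Icc q.1 q.2) ↔ e x ∈ ({e p} : Set F') := by rw [hp]
    simp only [Set.mem_iInter, Set.mem_singleton_iff, e.injective.eq_iff] at this
    rw [Set.mem_singleton_iff, ← this]
    simp only [Set.mem_iInter, Set.mem_ofPred_eq]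
    constructor
    · intro h q hq
      have := h (e.symm q.1, e.symm q.2) (by simpa using hq)
      exact ⟨(e.symm_apply_le).1 this.1, (e.le_symm_apply).1 this.2⟩
    · intro h q hq
      exact ⟨e.le_iff_le.1 (h _ hq).1, e.le_iff_le.1 (h _ hq).2⟩

theorem OrderCompact.preimage_orderIso {F' : Type*} [Lattice F'] (e : F ≃o F') {S : Set F'}
    (hS : OrderCompact S) : OrderCompact (e ⁻¹' S) := by
  intro U hU
  obtain ⟨p, hpS, hp⟩ := hS (U.map e) hU
  refine ⟨e.symm p, by simpa using hpS, OrderConvergesTo.of_map_orderIso e ?_⟩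
  simpa using hp

/-- If all order intervals are order compact, the order is Dedekind complete. -/
theorem exists_isLUB_of_orderCompact_Icc (h : ∀ u v : F, u ≤ v → OrderCompact (Set.Icc u v))
    {S : Set F} (hne : S.Nonempty) (hbdd : BddAbove S) : ∃ a, IsLUB S a := by
  obtain ⟨u, hu⟩ := hne
  obtain ⟨v, hv⟩ := hbdd
  have hvT : v ∈ upperBounds (supClosure S) := by rwa [upperBounds_supClosure]
  have huT : u ∈ supClosure S := subset_supClosure hu
  have : Nonempty (supClosure S) := ⟨⟨u, huT⟩⟩
  have : IsDirectedOrder (supClosure S) :=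
    ⟨fun (x y : supClosure S) => ⟨⟨x.1 ⊔ y.1, supClosed_supClosure x.2 y.2⟩,
      Subtype.coe_le_coe.1 le_sup_left, Subtype.coe_le_coe.1 le_sup_right⟩⟩
  let G : Filter F := Filter.map ((↑) : supClosure S → F) Filter.atTop
  have hG : ∀ t ∈ supClosure S, Set.Icc t v ∈ G := by
    intro t ht
    refine Filter.mem_map.2 ?_
    filter_upwards [Filter.mem_atTop (⟨t, ht⟩ : supClosure S)] with x hx
    exact ⟨hx, hvT x.2⟩
  let U := Ultrafilter.of G
  have hUG : (U : Filter F) ≤ G := Ultrafilter.of_le G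
  obtain ⟨p, -, hp⟩ := h u v (hv hu) U (hUG (hG u huT))
  refine ⟨p, isLUB_supClosure.1 ⟨fun t ht => hp.le_of_Ici_mem ?_, fun b hb => hp.le_of_Iic_mem ?_⟩⟩
  · exact Filter.mem_of_superset (hUG (hG t ht)) Set.Icc_subset_Ici_self
  · exact hUG (Filter.univ_mem' (f := Filter.atTop) fun x : supClosure S => hb x.2)

end Lattice

section Disjoint

variable {F : Type*} [Lattice F] [Zero F]

theorem inf_eq_zero_of_le {a b c d : F} (ha : 0 ≤ a) (hb : 0 ≤ b) (hac : a ≤ c) (hbd : b ≤ d)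
    (h : c ⊓ d = 0) : a ⊓ b = 0 :=
  le_antisymm ((inf_le_inf hac hbd).trans_eq h) (le_inf ha hb)

/-- If below any two elements of `(0, g]` there are disjoint elements of `(0, g]`, then a finite
family can be shrunk so as to be disjoint from some element below a given one. -/
theorem exists_disjoint_family_left {g : F}
    (hg : ∀ c d : Set.Ioc 0 g, ∃ c' ≤ c, ∃ d' ≤ d, (c' : F) ⊓ d' = 0)
    {ι : Type*} (s : Finset ι) (a : ι → Set.Ioc 0 g) (c : Set.Ioc 0 g) :
    ∃ c' ≤ c, ∃ a' ≤ a, ∀ i ∈ s, (c' : F) ⊓ a' i = 0 := by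
  classical
  induction s using Finset.induction_on with
  | empty => exact ⟨c, le_rfl, a, le_rfl, by simp⟩
  | insert i s hi ih =>
    obtain ⟨c₁, hc₁, a₁, ha₁, h₁⟩ := ih
    obtain ⟨c₂, hc₂, d, hd, h₂⟩ := hg c₁ (a₁ i)
    refine ⟨c₂, hc₂.trans hc₁, Function.update a₁ i d, ?_, ?_⟩
    · rw [update_le_iff]
      exact ⟨hd.trans (ha₁ i), fun j _ => ha₁ j⟩
    · intro j hj
      by_cases hji : j = i
      · subst hji
        simpa using h₂
      · rw [Function.update_of_ne hji]
        exact inf_eq_zero_of_le c₂.2.1.le (a₁ j).2.1.le hc₂ le_rfl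
          (h₁ j ((Finset.mem_insert.1 hj).resolve_left hji))

theorem exists_disjoint_families {g : F}
    (hg : ∀ c d : Set.Ioc 0 g, ∃ c' ≤ c, ∃ d' ≤ d, (c' : F) ⊓ d' = 0)
    {ι κ : Type*} (s : Finset ι) (t : Finset κ) (a : ι → Set.Ioc 0 g) (c : κ → Set.Ioc 0 g) :
    ∃ a' ≤ a, ∃ c' ≤ c, ∀ i ∈ s, ∀ k ∈ t, (a' i : F) ⊓ c' k = 0 := by
  classical
  induction t using Finset.induction_on with
  | empty => exact ⟨a, le_rfl, c, le_rfl, by simp⟩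
  | insert k t hk ih =>
    obtain ⟨a₁, ha₁, c₁, hc₁, h₁⟩ := ih
    obtain ⟨d, hd, a₂, ha₂, h₂⟩ := exists_disjoint_family_left hg s a₁ (c₁ k)
    refine ⟨a₂, ha₂.trans ha₁, Function.update c₁ k d, ?_, ?_⟩
    · rw [update_le_iff]
      exact ⟨hd.trans (hc₁ k), fun j _ => hc₁ j⟩
    · intro i hi j hj
      by_cases hjk : j = k
      · subst hjk
        simpa [inf_comm] using h₂ i hi
      · rw [Function.update_of_ne hjk]
        exact inf_eq_zero_of_le (a₂ i).2.1.le (c₁ j).2.1.le (ha₂ i) le_rfl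
          (h₁ i hi j ((Finset.mem_insert.1 hj).resolve_left hjk))

end Disjoint

section Group

variable {F : Type*} [Lattice F] [AddCommGroup F] [IsOrderedAddMonoid F]

theorem inf_add_eq_zero {e f f' : F} (he : 0 ≤ e) (hf : 0 ≤ f) (hf' : 0 ≤ f') (h : e ⊓ f = 0)
    (h' : e ⊓ f' = 0) : e ⊓ (f + f') = 0 := by
  refine le_antisymm ?_ (le_inf he (add_nonneg hf hf'))
  have h1 : e ⊓ (f + f') - f ≤ e ⊓ f' :=
    le_inf ((sub_le_self _ hf).trans inf_le_left) (sub_le_iff_le_add'.2 inf_le_right)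
  rw [h', sub_nonpos] at h1
  exact h ▸ le_inf inf_le_left h1

theorem inf_sum_eq_zero {ι : Type*} {e : F} (he : 0 ≤ e) (s : Finset ι) (f : ι → F)
    (hf : ∀ i ∈ s, 0 ≤ f i) (h : ∀ i ∈ s, e ⊓ f i = 0) : e ⊓ ∑ i ∈ s, f i = 0 := by
  classical
  induction s using Finset.induction_on with
  | empty => simpa using he
  | insert i s hi ih =>
    rw [Finset.sum_insert hi]
    exact inf_add_eq_zero he (hf i (by simp))
      (Finset.sum_nonneg fun j hj => hf j (Finset.mem_insert_of_mem hj)) (h i (by simp))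
      (ih (fun j hj => hf j (Finset.mem_insert_of_mem hj))
        fun j hj => h j (Finset.mem_insert_of_mem hj))

theorem inf_nsmul_eq_zero {e f : F} (he : 0 ≤ e) (hf : 0 ≤ f) (h : e ⊓ f = 0) (n : ℕ) :
    e ⊓ n • f = 0 := by
  simpa using inf_sum_eq_zero he (Finset.range n) (fun _ => f) (fun _ _ => hf) fun _ _ => h

theorem exists_forall_not_le_and_not_le_sub
    (harch : ∀ x y : F, (∀ n : ℕ, 0 ≤ n • x ∧ n • x ≤ y) → x = 0) {g : F} (hg0 : 0 ≤ g)
    (hg : ∀ c d : Set.Ioc 0 g, ∃ c' ≤ c, ∃ d' ≤ d, (c' : F) ⊓ d' = 0)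
    (D : Finset (Set.Ioc 0 g)) :
    ∃ x ∈ Set.Icc 0 g, ∀ d ∈ D, ¬ (d : F) ≤ x ∧ ¬ (d : F) ≤ g - x := by
  obtain ⟨e, he, f, hf, hef⟩ := exists_disjoint_families hg D D id id
  set s : F := ∑ d ∈ D, (f d : F)
  have hs0 : 0 ≤ s := Finset.sum_nonneg fun d _ => (f d).2.1.le
  have hfs : ∀ d ∈ D, (f d : F) ≤ s := fun d hd =>
    Finset.single_le_sum (f := fun d => (f d : F)) (fun d _ => (f d).2.1.le) hd
  have key : ∀ d : Set.Ioc 0 g, ∃ n : ℕ, d ∈ D → ¬ (f d : F) ≤ g - g ⊓ n • s := by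
    intro d
    by_contra! hcon
    have hd : d ∈ D := (hcon 0).1
    have hle : ∀ n : ℕ, n • (f d : F) ≤ g ⊓ n • s := by
      intro n
      induction n with
      | zero => simpa using hg0
      | succ n ih =>
        refine le_inf ?_ (nsmul_le_nsmul_right (hfs d hd) _)
        rw [succ_nsmul]
        exact le_sub_iff_add_le'.1 ((hcon n).2.trans (sub_le_sub_left ih g))
    exact (f d).2.1.ne' (harch _ g fun n =>
      ⟨nsmul_nonneg (f d).2.1.le n, (hle n).trans inf_le_left⟩)
  choose N hN using key
  refine ⟨g ⊓ D.sup N • s, ⟨le_inf hg0 (nsmul_nonneg hs0 _), inf_le_left⟩, fun d hd => ⟨?_, ?_⟩⟩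
  · intro hle
    have h0 : (e d : F) ⊓ D.sup N • s = 0 :=
      inf_nsmul_eq_zero (e d).2.1.le hs0
        (inf_sum_eq_zero (e d).2.1.le D _ (fun k _ => (f k).2.1.le) (hef d hd)) _
    have hed : (e d : F) ≤ d := he d
    rw [inf_eq_left.2 ((hed.trans hle).trans inf_le_right)] at h0
    exact (e d).2.1.ne' h0
  · intro hle
    have hfd : (f d : F) ≤ d := hf d
    refine hN d hd ((hfd.trans hle).trans (sub_le_sub_left (inf_le_inf_left g ?_) g))
    exact nsmul_le_nsmul_left hs0 (Finset.le_sup hd)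

/-- If any two elements of `(0, g]` can be shrunk to disjoint ones, then some ultrafilter on `[0, g]`
contains no order interval omitting `0` or `g`, so `[0, g]` is not order compact. -/
theorem not_orderCompact_Icc_of_forall_exists_disjoint
    (harch : ∀ x y : F, (∀ n : ℕ, 0 ≤ n • x ∧ n • x ≤ y) → x = 0) {g : F} (hg0 : 0 < g)
    (hg : ∀ c d : Set.Ioc 0 g, ∃ c' ≤ c, ∃ d' ≤ d, (c' : F) ⊓ d' = 0) :
    ¬ OrderCompact (Set.Icc 0 g) := by
  classical
  intro hcomp
  choose x hx hxD using exists_forall_not_le_and_not_le_sub harch hg0.le hg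
  let G : Filter F := Filter.map x Filter.atTop
  let U := Ultrafilter.of G
  have hUG : (U : Filter F) ≤ G := Ultrafilter.of_le G
  have hIcc : Set.Icc 0 g ∈ (U : Filter F) := hUG (Filter.univ_mem' (f := Filter.atTop) hx)
  have hU : ∀ d : Set.Ioc 0 g, ∀ᶠ y in (U : Filter F), ¬ (d : F) ≤ y ∧ ¬ (d : F) ≤ g - y := by
    intro d
    refine hUG (Filter.eventually_map.2 ?_)
    filter_upwards [Filter.eventually_ge_atTop {d}] with D hD
    exact hxD D d (hD (Finset.mem_singleton_self d))
  obtain ⟨p, -, S, -, hS, hp⟩ := hcomp U hIcc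
  have hmem : ∀ q ∈ S, q.1 ≤ 0 ∧ g ≤ q.2 := by
    intro q hq
    have hev : ∀ᶠ y in (U : Filter F), y ∈ Set.Icc q.1 q.2 ∧ y ∈ Set.Icc 0 g :=
      Filter.inter_mem (hS q hq) hIcc
    obtain ⟨z, hz⟩ := hev.exists
    constructor
    · by_contra hcon
      have hd : q.1⁺ ∈ Set.Ioc 0 g :=
        ⟨(posPart_nonneg _).lt_of_ne' (mt posPart_eq_zero.1 hcon),
          sup_le (hz.1.1.trans hz.2.2) hg0.le⟩
      obtain ⟨y, hy, hyd⟩ := (hev.and (hU ⟨_, hd⟩)).exists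
      exact hyd.1 (sup_le hy.1.1 hy.2.1)
    · by_contra hcon
      have hd : (g - q.2)⁺ ∈ Set.Ioc 0 g :=
        ⟨(posPart_nonneg _).lt_of_ne' (mt posPart_eq_zero.1 (mt sub_nonpos.1 hcon)),
          sup_le (sub_le_self _ (hz.2.1.trans hz.1.2)) hg0.le⟩
      obtain ⟨y, hy, hyd⟩ := (hev.and (hU ⟨_, hd⟩)).exists
      exact hyd.2 (sup_le (sub_le_sub_left hy.1.2 g) (sub_nonneg.2 hy.2.2))
  have h0 : (0 : F) ∈ ⋂ q ∈ S, Set.Icc q.1 q.2 := by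
    simp only [Set.mem_iInter]
    exact fun q hq => ⟨(hmem q hq).1, hg0.le.trans (hmem q hq).2⟩
  have h1 : g ∈ ⋂ q ∈ S, Set.Icc q.1 q.2 := by
    simp only [Set.mem_iInter]
    exact fun q hq => ⟨(hmem q hq).1.trans hg0.le, (hmem q hq).2⟩
  rw [hp, Set.mem_singleton_iff] at h0 h1
  exact hg0.ne (h0.trans h1.symm)

theorem eq_zero_of_forall_abs_le_inv_smul [Module ℝ F]
    (harch : ∀ x y : F, (∀ n : ℕ, 0 ≤ n • x ∧ n • x ≤ y) → x = 0) {x w : F}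
    (h : ∀ n : ℕ, |x| ≤ ((n : ℝ) + 1)⁻¹ • w) : x = 0 := by
  suffices hx : |x| = 0 from
    le_antisymm (hx ▸ le_abs_self x) (neg_nonpos.1 (hx ▸ neg_le_abs x))
  refine harch _ w fun n => ⟨nsmul_nonneg (abs_nonneg x) n, ?_⟩
  calc n • |x| ≤ (n + 1) • |x| := nsmul_le_nsmul_left (abs_nonneg x) n.le_succ
    _ ≤ (n + 1) • (((n : ℝ) + 1)⁻¹ • w) := nsmul_le_nsmul_right (h n) _
    _ = w := by
      rw [← Nat.cast_smul_eq_nsmul ℝ, smul_smul]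
      push_cast
      rw [mul_inv_cancel₀ (by positivity), one_smul]

end Group

section Module

variable {F : Type*} [Lattice F] [AddCommGroup F] [IsOrderedAddMonoid F] [Module ℝ F]
  [IsOrderedModule ℝ F]

/-- In an Archimedean vector lattice, a positive element that is not an atom dominates two
disjoint positive elements. -/
theorem isVLAtom_of_forall_inf_ne_zero
    (harch : ∀ x y : F, (∀ n : ℕ, 0 ≤ n • x ∧ n • x ≤ y) → x = 0) {d : F} (hd : 0 < d)
    (h : ∀ e f : F, 0 < e → e ≤ d → 0 < f → f ≤ d → e ⊓ f ≠ 0) : IsVLAtom d := by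
  refine ⟨hd, fun b hb0 hbd => ?_⟩
  have htot : ∀ s : ℝ, s • d ≤ b ∨ b ≤ s • d := by
    intro s
    rcases lt_or_ge s 0 with hs | hs
    · exact Or.inl ((smul_nonpos_of_nonpos_of_nonneg hs.le hd.le).trans hb0)
    rcases lt_or_ge 1 s with hs1 | hs1
    · refine Or.inr (hbd.trans ?_)
      simpa using smul_le_smul_of_nonneg_right hs1.le hd.le
    have hsd : s • d ≤ d := by simpa using smul_le_smul_of_nonneg_right hs1 hd.le
    by_contra! hcon
    refine h (b - s • d)⁺ (b - s • d)⁻ ?_ ?_ ?_ ?_ (posPart_inf_negPart_eq_zero _)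
    · exact (posPart_nonneg _).lt_of_ne' (mt posPart_eq_zero.1 (mt sub_nonpos.1 hcon.2))
    · exact sup_le ((sub_le_self _ (smul_nonneg hs hd.le)).trans hbd) hd.le
    · exact (negPart_nonneg _).lt_of_ne' (mt negPart_eq_zero.1 (mt sub_nonneg.1 hcon.1))
    · refine sup_le ?_ hd.le
      rw [neg_sub]
      exact (sub_le_self _ hb0).trans hsd
  have := PosSMulMono.toPosSMulStrictMono (α := ℝ) (β := F)
  let A : Set ℝ := {s | s • d ≤ b}
  have hA0 : A.Nonempty := ⟨0, by simpa [A] using hb0⟩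
  have hA1 : BddAbove A := by
    refine ⟨1, fun s hs => ?_⟩
    by_contra! hs1
    refine (smul_pos (sub_pos.2 hs1) hd).not_ge ?_
    rw [sub_smul, one_smul, sub_nonpos]
    exact le_trans hs hbd
  refine ⟨sSup A, 
    sub_eq_zero.1 (eq_zero_of_forall_abs_le_inv_smul harch (w := d) fun n => ?_)⟩
  have hε : (0 : ℝ) < ((n : ℝ) + 1)⁻¹ := by positivity
  refine sup_le ?_ ?_
  · rw [sub_le_iff_le_add, ← add_smul]
    refine (htot _).resolve_left fun hmem => ?_
    have := le_csSup hA1 hmem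
    linarith
  · rw [neg_sub, sub_le_comm, ← sub_smul]
    obtain ⟨s, hs, hlt⟩ := exists_lt_of_lt_csSup hA0 (sub_lt_self (sSup A) hε)
    exact (smul_le_smul_of_nonneg_right hlt.le hd.le).trans hs

theorem exists_isVLAtom_le_of_orderCompact_Icc
    (harch : ∀ x y : F, (∀ n : ℕ, 0 ≤ n • x ∧ n • x ≤ y) → x = 0) {g : F} (hg : 0 < g)
    (hcomp : OrderCompact (Set.Icc 0 g)) : ∃ a : F, IsVLAtom a ∧ a ≤ g := by
  by_contra! hno
  have hsplit : ∀ d : F, 0 < d → d ≤ g →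
      ∃ e f : F, 0 < e ∧ e ≤ d ∧ 0 < f ∧ f ≤ d ∧ e ⊓ f = 0 := by
    intro d hd hdg
    by_contra! hcon
    exact hno d (isVLAtom_of_forall_inf_ne_zero harch hd hcon) hdg
  refine not_orderCompact_Icc_of_forall_exists_disjoint harch hg (fun c d => ?_) hcomp
  by_cases hcd : (c : F) ⊓ d = 0
  · exact ⟨c, le_rfl, d, le_rfl, hcd⟩
  · obtain ⟨e, f, he, hec, hf, hfd, hef⟩ := hsplit (c ⊓ d)
      ((le_inf c.2.1.le d.2.1.le).lt_of_ne' hcd) (inf_le_left.trans c.2.2)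
    rw [le_inf_iff] at hec hfd
    exact ⟨⟨e, he, hec.1.trans c.2.2⟩, hec.1, ⟨f, hf, hfd.1.trans c.2.2⟩, hfd.2, hef⟩

theorem orderCompact_Icc_of_dedekindComplete_of_atomic
    (hsup : ∀ S : Set F, S.Nonempty → BddAbove S → ∃ a : F, IsLUB S a)
    (hatom : ∀ g : F, 0 < g → ∃ a : F, IsVLAtom a ∧ a ≤ g) (u v : F) :
    OrderCompact (Set.Icc u v) := by
  intro U hU
  have hinf : ∀ S : Set F, S.Nonempty → BddBelow S → ∃ a : F, IsGLB S a := by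
    intro S hS hb
    obtain ⟨a, ha⟩ := hsup (lowerBounds S) hb (hS.imp fun s hs b hb => hb hs)
    exact ⟨a, isLUB_lowerBounds.1 ha⟩
  let L : Set F := {x | u ≤ x ∧ Set.Ici x ∈ U}
  let R : Set F := {y | y ≤ v ∧ Set.Iic y ∈ U}
  have huL : u ∈ L := ⟨le_rfl, Filter.mem_of_superset hU Set.Icc_subset_Ici_self⟩
  have hvR : v ∈ R := ⟨le_rfl, Filter.mem_of_superset hU Set.Icc_subset_Iic_self⟩
  have hLR : ∀ x ∈ L, ∀ y ∈ R, x ≤ y := by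
    intro x hx y hy
    obtain ⟨z, hxz, hzy⟩ := Filter.nonempty_of_mem (Filter.inter_mem hx.2 hy.2)
    exact le_trans hxz hzy
  obtain ⟨l, hl⟩ := hsup L ⟨u, huL⟩ ⟨v, fun x hx => hLR x hx v hvR⟩
  obtain ⟨r, hr⟩ := hinf R ⟨v, hvR⟩ ⟨u, fun y hy => hLR u huL y hy⟩
  have hlr : l ≤ r := hl.2 fun x hx => hr.2 fun y hy => hLR x hx y hy
  have hrl : r ≤ l := by
    by_contra hne
    obtain ⟨a, ⟨ha0, ha⟩, hag⟩ := hatom (r - l) (sub_pos.2 (lt_of_le_not_ge hlr hne))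
    have hlar : l + a ≤ r := by rwa [← le_sub_iff_add_le']
    have := PosSMulMono.toPosSMulStrictMono (α := ℝ) (β := F)
    set h : F := (1 / 2 : ℝ) • a with hh
    have hh0 : 0 < h := smul_pos (by norm_num) ha0
    have hha : h + h = a := by
      rw [hh, ← add_smul]
      norm_num
    have hdich : ∀ x : F, (x ⊔ l) ⊓ (l + a) ≤ l + h ∨ l + h ≤ x ⊔ l := by
      intro x
      obtain ⟨t, ht⟩ := ha ((x ⊔ l) ⊓ (l + a) - l)
        (sub_nonneg.2 (le_inf le_sup_right (le_add_of_nonneg_right ha0.le)))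
        (sub_le_iff_le_add'.2 inf_le_right)
      rw [sub_eq_iff_eq_add'] at ht
      rcases le_total t (1 / 2) with h2 | h2
      · left
        rw [ht]
        gcongr
        exact smul_le_smul_of_nonneg_right h2 ha0.le
      · right
        refine le_trans ?_ (inf_le_left (b := l + a))
        rw [ht]
        gcongr
        exact smul_le_smul_of_nonneg_right h2 ha0.le
    have hmem : {x | (x ⊔ l) ⊓ (l + a) ≤ l + h} ∪ {x | l + h ≤ x ⊔ l} ∈ U :=
      Filter.univ_mem' hdich
    rcases Ultrafilter.union_mem_iff.1 hmem with hA | hB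
    · have hA' := Filter.inter_mem hA hU
      obtain ⟨y, hy⟩ := hsup _ (Filter.nonempty_of_mem hA') ⟨v, fun x hx => hx.2.2⟩
      have hyR : y ∈ R := ⟨hy.2 fun x hx => hx.2.2, Filter.mem_of_superset hA' hy.1⟩
      have hry : r ≤ y := hr.1 hyR
      have hyh : y ≤ y - h := by
        refine hy.2 fun x hx => ?_
        have hmax : (x ⊔ l) ⊔ (l + a) ≤ y :=
          sup_le (sup_le (hy.1 hx) (hlr.trans hry)) (hlar.trans hry)
        have hadd := add_le_add hx.1 hmax
        rw [inf_add_sup, ← hha] at hadd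
        refine le_sup_left.trans (b := x ⊔ l) ?_
        rw [← sub_nonneg] at hadd ⊢
        convert hadd using 1
        abel
      exact hh0.not_ge (by simpa using hyh)
    · have hB' := Filter.inter_mem hB hU
      obtain ⟨y, hy⟩ := hinf _ (Filter.nonempty_of_mem hB') ⟨u, fun x hx => hx.2.1⟩
      have hyL : y ∈ L := ⟨hy.2 fun x hx => hx.2.1, Filter.mem_of_superset hB' hy.1⟩
      have hyl : y ≤ l := hl.1 hyL
      have hyh : y + h ≤ y := by
        refine hy.2 fun x hx => ?_
        have hadd := add_le_add (le_inf (hy.1 hx) hyl) hx.1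
        rw [inf_add_sup] at hadd
        rw [← sub_nonneg] at hadd ⊢
        convert hadd using 1
        abel
      exact hh0.not_ge (by simpa using hyh)
  obtain rfl := le_antisymm hlr hrl
  refine ⟨l, ⟨hl.1 huL, hr.1 hvR⟩, L ×ˢ R, fun q hq => hLR _ hq.1 _ hq.2,
    fun q hq => Filter.inter_mem hq.1.2 hq.2.2, ?_⟩
  ext x
  simp only [Set.mem_iInter, Set.mem_singleton_iff]
  constructor
  · intro hx
    exact le_antisymm (hr.2 fun y hy => (hx (u, y) ⟨huL, hy⟩).2)
      (hl.2 fun z hz => (hx (z, v) ⟨hz, hvR⟩).1)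
  · rintro rfl q hq
    exact ⟨hl.1 hq.1, hr.1 hq.2⟩

theorem orderCompact_Icc_of_orderLocallyCompact
    (harch : ∀ x y : F, (∀ n : ℕ, 0 ≤ n • x ∧ n • x ≤ y) → x = 0)
    (hloc : ∀ (G : Filter F) (p : F), OrderConvergesTo G p → ∃ S ∈ G, OrderCompact S)
    {u v : F} (huv : u ≤ v) : OrderCompact (Set.Icc u v) := by
  set w : F := v - u with hw
  have hw0 : 0 ≤ w := sub_nonneg.2 huv
  let I : ℕ → Set F := fun n => Set.Icc (-(((n : ℝ) + 1)⁻¹ • w)) (((n : ℝ) + 1)⁻¹ • w)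
  have hanti : Antitone I := by
    intro m n hmn
    have : ((n : ℝ) + 1)⁻¹ • w ≤ ((m : ℝ) + 1)⁻¹ • w :=
      smul_le_smul_of_nonneg_right (by gcongr) hw0
    exact Set.Icc_subset_Icc (neg_le_neg this) this
  have hbasis := Filter.hasBasis_iInf_principal hanti.directed_ge
  have hpos (n : ℕ) : 0 ≤ ((n : ℝ) + 1)⁻¹ • w := smul_nonneg (by positivity) hw0
  have hconv : OrderConvergesTo (⨅ n, Filter.principal (I n)) (0 : F) := by
    refine ⟨Set.range fun n : ℕ => (-(((n : ℝ) + 1)⁻¹ • w), ((n : ℝ) + 1)⁻¹ • w), ?_, ?_, ?_⟩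
    · rintro _ ⟨n, rfl⟩
      exact neg_le_self (hpos n)
    · rintro _ ⟨n, rfl⟩
      exact hbasis.mem_of_mem (i := n) trivial
    · ext x
      simp only [Set.mem_iInter, Set.mem_singleton_iff, Set.forall_mem_range]
      constructor
      · intro hx
        exact eq_zero_of_forall_abs_le_inv_smul harch fun n =>
          sup_le (hx n).2 (neg_le.1 (hx n).1)
      · rintro rfl n
        exact ⟨neg_nonpos.2 (hpos n), hpos n⟩
  obtain ⟨S, hSG, hS⟩ := hloc _ _ hconv
  obtain ⟨n, -, hn⟩ := hbasis.mem_iff.1 hSG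
  have hc : OrderCompact (Set.Icc 0 (((n : ℝ) + 1)⁻¹ • w)) :=
    hS.Icc_of_subset ((Set.Icc_subset_Icc_left (neg_nonpos.2 (hpos n))).trans hn)
  have hr : (0 : ℝ) < ((n : ℝ) + 1)⁻¹ := by positivity
  convert hc.preimage_orderIso ((OrderIso.subRight u).trans (OrderIso.smulRight hr)) using 1
  ext x
  have h1 : 0 ≤ ((n : ℝ) + 1)⁻¹ • (x - u) ↔ u ≤ x := by
    rw [smul_nonneg_iff_nonneg_of_pos_left hr, sub_nonneg]
  have h2 : ((n : ℝ) + 1)⁻¹ • (x - u) ≤ ((n : ℝ) + 1)⁻¹ • w ↔ x ≤ v := by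
    rw [smul_le_smul_iff_of_pos_left hr, hw, sub_le_sub_iff_right]
  simp [h1, h2]

end Module

/-- An Archimedean vector lattice is Dedekind complete and atomic iff every
order interval is order compact iff it is order locally compact. -/
theorem dedekindCompleteAtomic_iff_intervals_orderCompact_iff_orderLocallyCompact
    {F : Type*} [Lattice F] [AddCommGroup F] [Module ℝ F]
    (hadd : ∀ x y z : F, x ≤ y → x + z ≤ y + z)
    (hsmul : ∀ (t : ℝ) (x : F), 0 ≤ t → 0 ≤ x → 0 ≤ t • x)
    (harch : ∀ x y : F, (∀ n : ℕ, 0 ≤ n • x ∧ n • x ≤ y) → x = 0) :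
    List.TFAE
      [(∀ S : Set F, S.Nonempty → BddAbove S → ∃ a : F, IsLUB S a) ∧
         (∀ g : F, 0 < g → ∃ a : F, IsVLAtom a ∧ a ≤ g),
       ∀ u v : F, u ≤ v → OrderCompact (Set.Icc u v),
       ∀ (G : Filter F) (p : F), OrderConvergesTo G p → ∃ S ∈ G, OrderCompact S] := by
  have : IsOrderedAddMonoid F := ⟨fun x y h z => hadd x y z h, fun x y h z => by
    simpa only [add_comm z] using hadd x y z h⟩
  have : IsOrderedModule ℝ F := .of_smul_nonneg fun t ht x hx => hsmul t x ht hx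
  tfae_have 1 → 2 := fun h u v _ => orderCompact_Icc_of_dedekindComplete_of_atomic h.1 h.2 u v
  tfae_have 2 → 1 := fun h =>
    ⟨fun S hne hbdd => exists_isLUB_of_orderCompact_Icc h hne hbdd,
      fun g hg => exists_isVLAtom_le_of_orderCompact_Icc harch hg (h 0 g hg.le)⟩
  tfae_have 2 → 3 := by
    rintro h G p ⟨S, hle, hS, hp⟩
    rcases S.eq_empty_or_nonempty with rfl | ⟨q, hq⟩
    · refine ⟨Set.Icc p p, ?_, h p p le_rfl⟩
      rw [Set.Icc_self, ← hp]
      simp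
    · exact ⟨_, hS q hq, h _ _ (hle q hq)⟩
  tfae_have 3 → 2 := fun h u v huv => orderCompact_Icc_of_orderLocallyCompact harch h huv
  tfae_finish
end

section
/- Let S be a Tychonoff (completely regular Hausdorff) topological space. The unit ball of C_b(S,ℝ), i.e., the order interval [−1, 1] = {f ∈ C_b(S,ℝ) : −1 ≤ f ≤ 1 pointwise}, is order pre-compact (every ultrafilter on C_b(S,ℝ) containing it is order Cauchy) if and only if the set of isolated points of S is dense in S. -/
theorem exists_injOn_mem_of_infinite {α β : Type*} [Nonempty β] (W : α → Set β) (T : Finset α)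
    (h : ∀ a ∈ T, (W a).Infinite) :
    ∃ x : α → β, Set.InjOn x T ∧ ∀ a ∈ T, x a ∈ W a := by
  classical
  induction T using Finset.induction_on with
  | empty => exact ⟨fun _ => Classical.arbitrary β, by simp, by simp⟩
  | insert a T ha ih =>
    obtain ⟨x, hinj, hx⟩ := ih fun b hb => h b (Finset.mem_insert_of_mem hb)
    obtain ⟨y, hy, hyx⟩ := (h a (Finset.mem_insert_self a T)).exists_notMem_finset (T.image x)
    have hne : ∀ b ∈ T, b ≠ a := fun b hb hba => ha (hba ▸ hb)
    have hup : ∀ b ∈ T, Function.update x a y b = x b := fun b hb =>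
      Function.update_of_ne (hne b hb) _ _
    have hyx' : ∀ b ∈ T, x b ≠ y := fun b hb hby => hyx (Finset.mem_image.2 ⟨b, hb, hby⟩)
    refine ⟨Function.update x a y, ?_, ?_⟩
    · rw [Finset.coe_insert, Set.injOn_insert (by simpa using ha)]
      refine ⟨fun b hb c hc hbc => hinj hb hc ?_, ?_⟩
      · rwa [hup b hb, hup c hc] at hbc
      · rintro ⟨b, hb, hba⟩
        rw [hup b hb, Function.update_self] at hba
        exact hyx' b hb hba
    · intro b hb
      rcases Finset.mem_insert.1 hb with rfl | hb
      · simpa using hy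
      · rw [hup b hb]
        exact hx b hb

namespace BoundedContinuousFunction

open scoped Topology

variable {S : Type*} [TopologicalSpace S]

theorem mem_Icc_neg_one_one_iff {f : BoundedContinuousFunction S ℝ} :
    f ∈ Set.Icc (-1 : BoundedContinuousFunction S ℝ) 1 ↔ ∀ s, -1 ≤ f s ∧ f s ≤ 1 :=
  ⟨fun h s => ⟨h.1 s, h.2 s⟩, fun h => ⟨fun s => (h s).1, fun s => (h s).2⟩⟩

theorem exists_mem_Icc_eq_neg_one_eq_one [CompletelyRegularSpace S] [T2Space S]
    (P N : Finset S) (hPN : Disjoint P N) :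
    ∃ f ∈ Set.Icc (-1 : BoundedContinuousFunction S ℝ) 1,
      (∀ p ∈ P, f p = -1) ∧ ∀ n ∈ N, f n = 1 := by
  have hN : IsClosed (N : Set S) := N.finite_toSet.isClosed
  have key : ∀ p : S, ∃ g : S → ℝ, Continuous g ∧ (∀ s, 0 ≤ g s ∧ g s ≤ 1) ∧
      (p ∈ P → g p = 0) ∧ ∀ n ∈ N, g n = 1 := by
    intro p
    by_cases hp : p ∈ P
    · obtain ⟨g, hg, hgp, hgN⟩ := CompletelyRegularSpace.completely_regular p (N : Set S) hN
        (fun h => Finset.disjoint_left.1 hPN hp h)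
      exact ⟨fun s => (g s : ℝ), by fun_prop, fun s => (g s).2, fun _ => by simp [hgp],
        fun n hn => by simp [hgN hn]⟩
    · exact ⟨fun _ => 1, continuous_const, by simp, fun h => absurd h hp, by simp⟩
  choose g hg hg01 hgP hgN using key
  have h0 : ∀ s, 0 ≤ ∏ p ∈ P, g p s := fun s => Finset.prod_nonneg fun p _ => (hg01 p s).1
  have h1 : ∀ s, ∏ p ∈ P, g p s ≤ 1 := fun s =>
    Finset.prod_le_one (fun p _ => (hg01 p s).1) fun p _ => (hg01 p s).2
  refine ⟨ofNormedAddCommGroup (fun s => 2 * ∏ p ∈ P, g p s - 1) (by fun_prop) 1 ?_, ?_, ?_, ?_⟩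
  · intro s
    rw [Real.norm_eq_abs, abs_le]
    constructor <;> linarith [h0 s, h1 s]
  · rw [mem_Icc_neg_one_one_iff]
    intro s
    simp only [coe_ofNormedAddCommGroup]
    constructor <;> linarith [h0 s, h1 s]
  · intro p hp
    simp only [coe_ofNormedAddCommGroup]
    rw [Finset.prod_eq_zero (f := fun i => g i p) hp (hgP p hp)]
    norm_num
  · intro n hn
    simp only [coe_ofNormedAddCommGroup]
    rw [Finset.prod_eq_one fun p _ => hgN p n hn]
    norm_num

/-- The unit ball is not covered by finitely many sets of functions each of which, at infinitely
many points, does not attain both values `-1` and `1`. -/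
theorem exists_mem_Icc_forall_notMem [CompletelyRegularSpace S] [T2Space S] [Nonempty S]
    (T : Finset (Set (BoundedContinuousFunction S ℝ)))
    (hT : ∀ A ∈ T, {p | ∀ f ∈ A, ∀ g ∈ A, ¬ (f p = -1 ∧ g p = 1)}.Infinite) :
    ∃ f ∈ Set.Icc (-1 : BoundedContinuousFunction S ℝ) 1, ∀ A ∈ T, f ∉ A := by
  classical
  obtain ⟨x, hinj, hx⟩ := exists_injOn_mem_of_infinite
    (fun A : Set (BoundedContinuousFunction S ℝ) =>
      {p | ∀ f ∈ A, ∀ g ∈ A, ¬ (f p = -1 ∧ g p = 1)}) T hT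
  obtain ⟨f, hf, hfP, hfN⟩ := exists_mem_Icc_eq_neg_one_eq_one
    ({A ∈ T | ∃ g ∈ A, g (x A) = 1}.image x) ({A ∈ T | ¬ ∃ g ∈ A, g (x A) = 1}.image x) (by
      rw [Finset.disjoint_left]
      intro p hp hp'
      obtain ⟨A, hA, rfl⟩ := Finset.mem_image.1 hp
      obtain ⟨B, hB, hBA⟩ := Finset.mem_image.1 hp'
      rw [Finset.mem_filter] at hA hB
      obtain rfl := hinj hB.1 hA.1 hBA
      exact hB.2 hA.2)
  refine ⟨f, hf, fun A hA hfA => ?_⟩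
  by_cases h : ∃ g ∈ A, g (x A) = 1
  · obtain ⟨g, hg, hg1⟩ := h
    refine hx A hA f hfA g hg ⟨hfP _ (Finset.mem_image_of_mem x ?_), hg1⟩
    exact Finset.mem_filter.2 ⟨hA, g, hg, hg1⟩
  · exact h ⟨f, hfA, hfN _ (Finset.mem_image_of_mem x (Finset.mem_filter.2 ⟨hA, h⟩))⟩

theorem dense_isolated_of_orderPreCompact_Icc [CompletelyRegularSpace S] [T2Space S]
    (h : OrderPreCompact (Set.Icc (-1 : BoundedContinuousFunction S ℝ) 1)) :
    Dense {s : S | IsOpen ({s} : Set S)} := by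
  classical
  by_contra hd
  obtain ⟨x₀, hx₀⟩ : ∃ x₀, x₀ ∉ closure {s : S | IsOpen ({s} : Set S)} := by
    simpa [Dense] using hd
  have : Nonempty S := ⟨x₀⟩
  have hinf : ∀ W : Set S, IsOpen W → W.Nonempty →
      W ⊆ (closure {s : S | IsOpen ({s} : Set S)})ᶜ → W.Infinite := by
    rintro W hW ⟨p, hp⟩ hWV
    have : (𝓝[≠] p).NeBot := by
      rw [Filter.neBot_iff, Ne, ← isOpen_singleton_iff_punctured_nhds]
      exact fun hpo => hWV hp (subset_closure hpo)
    exact infinite_of_mem_nhds p (hW.mem_nhds hp)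
  obtain ⟨g, hg, hg0, hg1⟩ := CompletelyRegularSpace.completely_regular x₀ _ isClosed_closure hx₀
  let b : BoundedContinuousFunction S ℝ :=
    ofNormedAddCommGroup (fun s => 1 - (g s : ℝ)) (by fun_prop) 1 fun s => by
      rw [Real.norm_eq_abs, abs_le]
      constructor <;> linarith [(g s).2.1, (g s).2.2]
  have hb : ∀ s, b s = 1 - (g s : ℝ) := fun _ => rfl
  obtain ⟨U, hU⟩ := Ultrafilter.exists_ultrafilter_of_finite_inter_nonempty
    {B | ∃ A : Set (BoundedContinuousFunction S ℝ),
      {p | ∀ f ∈ A, ∀ g ∈ A, ¬ (f p = -1 ∧ g p = 1)}.Infinite ∧ B = Set.Icc (-1) 1 \ A} (by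
    intro T hT
    choose! A hA hTA using hT
    obtain ⟨f, hf, hfA⟩ := exists_mem_Icc_forall_notMem (T.image A) (by
      intro B hB
      obtain ⟨C, hC, rfl⟩ := Finset.mem_image.1 hB
      exact hA hC)
    refine ⟨f, fun B hB => ?_⟩
    rw [hTA hB]
    exact ⟨hf, hfA _ (Finset.mem_image_of_mem A hB)⟩)
  have hsmall : ∀ A : Set (BoundedContinuousFunction S ℝ),
      {p | ∀ f ∈ A, ∀ g ∈ A, ¬ (f p = -1 ∧ g p = 1)}.Infinite → Set.Icc (-1) 1 \ A ∈ U :=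
    fun A hA => hU ⟨A, hA, rfl⟩
  have hball : Set.Icc (-1 : BoundedContinuousFunction S ℝ) 1 ∈ U := by
    have := hsmall ∅ ((hinf _ isClosed_closure.isOpen_compl ⟨x₀, hx₀⟩ subset_rfl).mono (by simp))
    simpa using this
  obtain ⟨I, hI, hIU, hI0⟩ := h U hball
  have hbmem : b ∈ ⋂ q ∈ I, Set.Icc q.1 q.2 := by
    refine Set.mem_iInter₂.2 fun q hq => ?_
    have h0 : (0 : BoundedContinuousFunction S ℝ) ∈ Set.Icc q.1 q.2 := by
      have : (0 : BoundedContinuousFunction S ℝ) ∈ ⋂ q ∈ I, Set.Icc q.1 q.2 := by rw [hI0]; rfl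
      exact Set.mem_iInter₂.1 this q hq
    refine ⟨h0.1.trans fun s => ?_, fun s => ?_⟩
    · change (0 : ℝ) ≤ b s
      linarith [hb s, (g s).2.2]
    · change b s ≤ q.2 s
      by_contra! hs
      obtain ⟨A, hAU, hA⟩ := Filter.mem_prod_self_iff.1 (Filter.mem_map.1 (hIU q hq))
      have hAinf : {p | ∀ f ∈ A, ∀ g ∈ A, ¬ (f p = -1 ∧ g p = 1)}.Infinite := by
        refine (hinf {p | q.2 p < b p} (isOpen_lt q.2.continuous b.continuous) ⟨s, hs⟩ ?_).mono ?_
        · intro p hp hpc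
          have h1 : (0 : ℝ) ≤ q.2 p := h0.2 p
          have h2 : b p = 0 := by simp [hb, hg1 hpc]
          have h3 : q.2 p < b p := hp
          linarith
        · rintro p hp f₁ hf₁ f₂ hf₂ ⟨hm, hM⟩
          have h1 : f₂ p - f₁ p ≤ q.2 p := (hA (Set.mk_mem_prod hf₂ hf₁)).2 p
          have h3 : q.2 p < b p := hp
          linarith [hb p, (g p).2.1]
      have := U.neBot.nonempty_of_mem (Filter.inter_mem hAU (hsmall A hAinf))
      obtain ⟨f, hf, -, hf'⟩ := this
      exact hf' hf
  rw [hI0] at hbmem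
  have : b x₀ = 0 := by rw [Set.mem_singleton_iff.1 hbmem]; rfl
  rw [hb, hg0] at this
  norm_num at this

theorem orderPreCompact_Icc_of_dense_isolated [T1Space S]
    (hd : Dense {s : S | IsOpen ({s} : Set S)}) :
    OrderPreCompact (Set.Icc (-1 : BoundedContinuousFunction S ℝ) 1) := by
  classical
  intro U hU
  have hlim : ∀ s, ∃ c : ℝ,
      Filter.Tendsto (fun f : BoundedContinuousFunction S ℝ => f s) U (𝓝 c) := by
    intro s
    obtain ⟨c, -, hc⟩ := (isCompact_Icc (a := (-1 : ℝ)) (b := 1)).ultrafilter_le_nhds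
      (U.map fun f => f s) (by
        rw [Filter.le_principal_iff, Ultrafilter.mem_coe, Ultrafilter.mem_map]
        exact Filter.mem_of_superset hU fun f hf => mem_Icc_neg_one_one_iff.1 hf s)
    exact ⟨c, hc⟩
  choose c hc using hlim
  have hbump : ∀ s : S, IsOpen ({s} : Set S) → ∀ ε : ℝ, 0 < ε → ε ≤ 2 →
      ∃ v : BoundedContinuousFunction S ℝ, v s = ε ∧ ∀ t ≠ s, v t = 2 := by
    intro s hs ε hε hε2
    have hcl : IsClopen ({s} : Set S) := ⟨isClosed_singleton, hs⟩
    refine ⟨ofNormedAddCommGroup (fun t => if t ∈ ({s} : Set S) then ε else 2) ?_ 2 ?_, ?_, ?_⟩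
    · exact continuous_const.if (by simp [hcl.frontier_eq]) continuous_const
    · intro t
      split_ifs
      · rw [Real.norm_eq_abs, abs_of_pos hε]; exact hε2
      · norm_num
    · simp
    · intro t ht
      simp [ht]
  refine ⟨{q | ∃ s : S, IsOpen ({s} : Set S) ∧ ∃ ε : ℝ, 0 < ε ∧ ε ≤ 2 ∧
    (q.2 s = ε ∧ ∀ t ≠ s, q.2 t = 2) ∧ q.1 = -q.2}, ?_, ?_, ?_⟩
  · rintro ⟨u, v⟩ ⟨s, hs, ε, hε, hε2, ⟨hvs, hvt⟩, hu⟩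
    dsimp only at hvs hvt hu ⊢
    subst hu
    intro t
    change -v t ≤ v t
    by_cases hts : t = s
    · subst hts; linarith
    · linarith [hvt t hts]
  · rintro ⟨u, v⟩ ⟨s, hs, ε, hε, hε2, ⟨hvs, hvt⟩, hu⟩
    dsimp only at hvs hvt hu ⊢
    subst hu
    rw [Filter.mem_map, Filter.mem_prod_self_iff]
    refine ⟨_, Filter.inter_mem hU (hc s (Metric.ball_mem_nhds (c s) (half_pos hε))), ?_⟩
    rintro ⟨f₁, f₂⟩ ⟨⟨hf₁, hd₁⟩, hf₂, hd₂⟩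
    rw [mem_Icc_neg_one_one_iff] at hf₁ hf₂
    rw [Set.mem_preimage, Metric.mem_ball, Real.dist_eq, abs_lt] at hd₁ hd₂
    have hle : ∀ t, -v t ≤ f₁ t - f₂ t ∧ f₁ t - f₂ t ≤ v t := by
      intro t
      by_cases hts : t = s
      · subst hts
        constructor <;> linarith [hd₁.1, hd₁.2, hd₂.1, hd₂.2]
      · rw [hvt t hts]
        constructor <;> linarith [(hf₁ t).1, (hf₁ t).2, (hf₂ t).1, (hf₂ t).2]
    exact ⟨fun t => (hle t).1, fun t => (hle t).2⟩
  · refine Set.eq_singleton_iff_unique_mem.2 ⟨?_, ?_⟩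
    · refine Set.mem_iInter₂.2 ?_
      rintro ⟨u, v⟩ ⟨s, hs, ε, hε, hε2, ⟨hvs, hvt⟩, hu⟩
      dsimp only at hvs hvt hu ⊢
      subst hu
      have hv : ∀ t, 0 ≤ v t := by
        intro t
        by_cases hts : t = s
        · subst hts; linarith
        · linarith [hvt t hts]
      exact ⟨fun t => neg_nonpos.2 (hv t), hv⟩
    · intro f hf
      have hzero : ∀ s : S, IsOpen ({s} : Set S) → f s = 0 := by
        intro s hs
        have hbd : ∀ ε : ℝ, 0 < ε → ε ≤ 2 → |f s| ≤ ε := by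
          intro ε hε hε2
          obtain ⟨v, hvs, hvt⟩ := hbump s hs ε hε hε2
          have hfv := Set.mem_iInter₂.1 hf (-v, v) ⟨s, hs, ε, hε, hε2, ⟨hvs, hvt⟩, rfl⟩
          rw [abs_le, ← hvs]
          exact ⟨hfv.1 s, hfv.2 s⟩
        by_contra hne
        have hpos := abs_pos.2 hne
        have h1 := hbd (min (|f s| / 2) 2) (by positivity) (min_le_right _ _)
        linarith [min_le_left (|f s| / 2) 2]
      ext t
      exact congrFun (Continuous.ext_on hd f.continuous (continuous_const (y := (0 : ℝ)))
        fun s hs => hzero s hs) t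

end BoundedContinuousFunction

/-- For a Tychonoff space `S`, the unit ball `[-1, 1]` of `C_b(S, ℝ)` is
order pre-compact iff the set of isolated points of `S` is dense in `S`. -/
theorem unitBall_Cb_orderPreCompact_iff_denseIsolatedPoints
    {S : Type*} [TopologicalSpace S] [CompletelyRegularSpace S] [T2Space S] :
    OrderPreCompact (Set.Icc (-1 : BoundedContinuousFunction S ℝ) 1) ↔
      Dense {s : S | IsOpen ({s} : Set S)} :=
  ⟨BoundedContinuousFunction.dense_isolated_of_orderPreCompact_Icc,
    BoundedContinuousFunction.orderPreCompact_Icc_of_dense_isolated⟩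
end

section
/- Let K be a compact Hausdorff topological space. The unit ball of C(K,ℝ), i.e., the order interval [−1, 1] = {f ∈ C(K,ℝ) : −1 ≤ f ≤ 1 pointwise}, is order compact (every ultrafilter on C(K,ℝ) containing it order converges to some element of it) if and only if K is homeomorphic to the Stone–Čech compactification of some discrete topological space. -/
open Filter Topology

/-- Changing a continuous function at an isolated point keeps it continuous. -/
theorem Continuous.update_of_isOpen_singleton {X Y : Type*} [TopologicalSpace X] [T1Space X]
    [TopologicalSpace Y] [DecidableEq X] {f : X → Y} (hf : Continuous f) {a : X}
    (ha : IsOpen {a}) (c : Y) : Continuous (Function.update f a c) := by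
  refine continuous_iff_continuousAt.2 fun x => ?_
  by_cases hx : x = a
  · subst hx
    rw [ContinuousAt, isOpen_singleton_iff_nhds_eq_pure _ |>.1 ha]
    exact tendsto_pure_nhds _ _
  · exact (continuousAt_update_of_ne hx).2 hf.continuousAt

/-- A nonempty open set without isolated points in a `T1` space is infinite. -/
theorem IsOpen.infinite_of_forall_not_isOpen_singleton {X : Type*} [TopologicalSpace X]
    [T1Space X] {V : Set X} (hV : IsOpen V) (hne : V.Nonempty)
    (h : ∀ x ∈ V, ¬ IsOpen {x}) : V.Infinite := by
  intro hfin
  obtain ⟨x, hx⟩ := hne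
  refine h x hx ?_
  have hx' : ({x} : Set X) = V \ (V \ {x}) := by
    rw [Set.sdiff_sdiff_cancel_left (Set.singleton_subset_iff.2 hx)]
  rw [hx']
  exact hV.sdiff (hfin.subset Set.sdiff_subset).isClosed

/-- Finitely many infinite sets are all met by each of two suitable disjoint finite sets. -/
theorem Finset.exists_disjoint_inter_nonempty_of_infinite {X : Type*} (s : Finset (Set X))
    (hs : ∀ V ∈ s, V.Infinite) :
    ∃ A B : Set X, A.Finite ∧ B.Finite ∧ Disjoint A B ∧
      ∀ V ∈ s, (A ∩ V).Nonempty ∧ (B ∩ V).Nonempty := by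
  classical
  induction s using Finset.induction_on with
  | empty => exact ⟨∅, ∅, Set.finite_empty, Set.finite_empty, Set.disjoint_empty _, by simp⟩
  | insert W s _ ih =>
    obtain ⟨A, B, hA, hB, hAB, h⟩ := ih fun V hV => hs V (Finset.mem_insert_of_mem hV)
    have hW : W.Infinite := hs W (Finset.mem_insert_self W s)
    obtain ⟨x, hxW, hx⟩ := (hW.sdiff hB).nonempty
    obtain ⟨y, hyW, hy⟩ := (hW.sdiff (hA.insert x)).nonempty
    refine ⟨insert x A, insert y B, hA.insert x, hB.insert y, ?_, ?_⟩
    · rw [Set.disjoint_insert_right, Set.disjoint_insert_left]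
      exact ⟨hy, hx, hAB⟩
    · intro V hV
      rcases Finset.mem_insert.1 hV with rfl | hV
      · exact ⟨⟨x, Set.mem_insert _ _, hxW⟩, ⟨y, Set.mem_insert _ _, hyW⟩⟩
      · exact ⟨(h V hV).1.mono (Set.inter_subset_inter_left _ (Set.subset_insert _ _)),
          (h V hV).2.mono (Set.inter_subset_inter_left _ (Set.subset_insert _ _))⟩

/-- A set of an ultrafilter refining the net `F` of finite sets contains `F t` for some `t` with any
prescribed element. -/
theorem Ultrafilter.exists_mem_of_mem_map_of_atTop {α β : Type*} {F : Finset α → β} {s : Set β}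
    (hs : s ∈ (Ultrafilter.of atTop).map F) (a : α) : ∃ t, a ∈ t ∧ F t ∈ s := by
  have ha : {t : Finset α | {a} ≤ t} ∈ Ultrafilter.of (atTop : Filter (Finset α)) :=
    Ultrafilter.of_le atTop (mem_atTop _)
  obtain ⟨t, hat, hts⟩ := Ultrafilter.nonempty_of_mem (inter_mem ha (Ultrafilter.mem_map.1 hs))
  exact ⟨t, Finset.singleton_subset_iff.1 hat, hts⟩

/-- If `Ω` maps densely into `K` and every `[-1, 1]`-valued function on `Ω` extends to `K`, then
the unit ball of `C(K, ℝ)` is order compact. -/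
theorem orderCompact_unitBall_of_extension {K Ω : Type*} [TopologicalSpace K] {j : Ω → K}
    (hj : DenseRange j)
    (hext : ∀ g : Ω → ℝ, (∀ ω, g ω ∈ Set.Icc (-1 : ℝ) 1) → ∃ p : C(K, ℝ), ∀ ω, p (j ω) = g ω) :
    OrderCompact (Set.Icc (-1 : C(K, ℝ)) 1) := by
  classical
  have le_of_dense {f g : C(K, ℝ)} (h : ∀ ω, f (j ω) ≤ g (j ω)) : f ≤ g := fun x =>
    hj.induction_on x (isClosed_le f.continuous g.continuous) h
  intro U hU
  have hlim : ∀ ω, ∃ c ∈ Set.Icc (-1 : ℝ) 1, Tendsto (fun f : C(K, ℝ) => f (j ω)) U (𝓝 c) := by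
    intro ω
    refine isCompact_Icc.ultrafilter_le_nhds (U.map fun f : C(K, ℝ) => f (j ω)) ?_
    rw [le_principal_iff]
    rw [Ultrafilter.mem_coe, Ultrafilter.mem_map]
    exact mem_of_superset hU fun f hf => ⟨hf.1 (j ω), hf.2 (j ω)⟩
  choose g hg hgU using hlim
  obtain ⟨p, hp⟩ := hext g hg
  have mem_of (u : C(K, ℝ)) (v : C(K, ℝ)) (h : Set.Icc u v ∈ U) : p ∈ Set.Icc u v := by
    refine ⟨le_of_dense fun ω => ?_, le_of_dense fun ω => ?_⟩ <;> rw [hp]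
    · exact ge_of_tendsto (hgU ω) (mem_of_superset h fun f hf => hf.1 (j ω))
    · exact le_of_tendsto (hgU ω) (mem_of_superset h fun f hf => hf.2 (j ω))
  refine ⟨p, mem_of _ _ hU, {q | q.1 ≤ q.2 ∧ Set.Icc q.1 q.2 ∈ U}, fun q hq => hq.1,
    fun q hq => hq.2, ?_⟩
  refine Set.Subset.antisymm (fun h hh => ?_) ?_
  swap
  · rintro _ rfl
    exact Set.mem_iInter₂.2 fun q hq => mem_of _ _ hq.2
  have hmem (u v : C(K, ℝ)) (huv : Set.Icc u v ∈ U) : h ∈ Set.Icc u v := by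
    obtain ⟨f, hf⟩ := U.nonempty_of_mem huv
    exact Set.mem_iInter₂.1 hh (u, v) ⟨hf.1.trans hf.2, huv⟩
  have h1 := hmem _ _ hU
  refine le_antisymm (le_of_dense fun ω => ?_) (le_of_dense fun ω => ?_) <;> by_contra! hlt
  · obtain ⟨c, hpc, hch⟩ := exists_between hlt
    obtain ⟨v, hv⟩ := hext (Function.update (fun _ => 1) ω c) fun ω' => by
      by_cases hω : ω' = ω
      · subst hω
        rw [Function.update_self]
        exact ⟨((hg ω').1.trans_eq (hp ω').symm).trans hpc.le, hch.le.trans (h1.2 (j ω'))⟩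
      · simp [hω]
    have hlt' : g ω < c := hp ω ▸ hpc
    have : h (j ω) ≤ v (j ω) := (hmem (-1) v (by
      filter_upwards [hU, (hgU ω).eventually_lt_const hlt'] with f hf hfc
      refine ⟨hf.1, le_of_dense fun ω' => ?_⟩
      rw [hv]
      by_cases hω : ω' = ω
      · subst hω
        simpa using hfc.le
      · simpa [hω] using hf.2 (j ω'))).2 (j ω)
    rw [hv, Function.update_self] at this
    linarith
  · obtain ⟨c, hhc, hcp⟩ := exists_between hlt
    obtain ⟨u, hu⟩ := hext (Function.update (fun _ => -1) ω c) fun ω' => by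
      by_cases hω : ω' = ω
      · subst hω
        rw [Function.update_self]
        exact ⟨(h1.1 (j ω')).trans hhc.le, hcp.le.trans ((hp ω').trans_le (hg ω').2)⟩
      · simp [hω]
    have hlt' : c < g ω := hp ω ▸ hcp
    have : u (j ω) ≤ h (j ω) := (hmem u 1 (by
      filter_upwards [hU, (hgU ω).eventually_const_lt hlt'] with f hf hfc
      refine ⟨le_of_dense fun ω' => ?_, hf.2⟩
      rw [hu]
      by_cases hω : ω' = ω
      · subst hω
        simpa using hfc.le
      · simpa [hω] using hf.1 (j ω'))).1 (j ω)
    rw [hu, Function.update_self] at this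
    linarith

/-- A function equal to `-1` on `A` and to `1` on `B`, for disjoint finite sets `A` and `B`. -/
theorem exists_mem_unitBall_eq_of_finite {K : Type*} [TopologicalSpace K] [CompactSpace K] [T2Space K]
    {A B : Set K} (hA : A.Finite) (hB : B.Finite)
    (hAB : Disjoint A B) :
    ∃ f ∈ Set.Icc (-1 : C(K, ℝ)) 1, (∀ x ∈ A, f x = -1) ∧ ∀ x ∈ B, f x = 1 := by
  obtain ⟨f, hfA, hfB, hf⟩ := exists_bounded_mem_Icc_of_closed_of_le hA.isClosed hB.isClosed hAB
    (show (-1 : ℝ) ≤ 1 by norm_num)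
  exact ⟨f, ⟨fun x => (hf x).1, fun x => (hf x).2⟩, fun x hx => hfA hx, fun x hx => hfB hx⟩

/-- If the unit ball of `C(K, ℝ)` is order compact, the isolated points of `K` are dense. -/
theorem dense_isolated_of_orderCompact_unitBall {K : Type*} [TopologicalSpace K] [CompactSpace K] [T2Space K]
    (h : OrderCompact (Set.Icc (-1 : C(K, ℝ)) 1)) :
    Dense {x : K | IsOpen {x}} := by
  intro x₀
  by_contra hx₀
  set W : Set K := (closure {x : K | IsOpen {x}})ᶜ
  have hWo : IsOpen W := isClosed_closure.isOpen_compl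
  have hWinf {V : Set K} (hV : IsOpen V) (hne : (V ∩ W).Nonempty) : (V ∩ W).Infinite :=
    (hV.inter hWo).infinite_of_forall_not_isOpen_singleton hne
      fun x hx hxo => hx.2 (subset_closure hxo)
  have hex (s : Finset (Set K)) : ∃ f ∈ Set.Icc (-1 : C(K, ℝ)) 1, ∀ V ∈ s, V.Infinite →
      (∃ x ∈ V, f x = -1) ∧ ∃ x ∈ V, f x = 1 := by
    classical
    obtain ⟨A, B, hA, hB, hAB, hs⟩ :=
      (s.filter Set.Infinite).exists_disjoint_inter_nonempty_of_infinite (by simp)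
    obtain ⟨f, hf, hfA, hfB⟩ := exists_mem_unitBall_eq_of_finite hA hB hAB
    refine ⟨f, hf, fun V hV hVi => ?_⟩
    obtain ⟨⟨x, hx⟩, y, hy⟩ := hs V (Finset.mem_filter.2 ⟨hV, hVi⟩)
    exact ⟨⟨x, hx.2, hfA x hx.1⟩, y, hy.2, hfB y hy.1⟩
  choose F hF hFV using hex
  set U : Ultrafilter C(K, ℝ) := (Ultrafilter.of atTop).map F
  have exists_mem {s : Set C(K, ℝ)} (hs : s ∈ U) {V : Set K} (hV : V.Infinite) :
      ∃ f ∈ s, (∃ x ∈ V, f x = -1) ∧ ∃ x ∈ V, f x = 1 := by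
    obtain ⟨t, htV, hts⟩ := Ultrafilter.exists_mem_of_mem_map_of_atTop hs V
    exact ⟨F t, hts, hFV t V htV hV⟩
  have hU : Set.Icc (-1 : C(K, ℝ)) 1 ∈ U := Ultrafilter.mem_map.2 (univ_mem' hF)
  obtain ⟨p, hp, S, -, hSU, hSp⟩ := h U hU
  have lower {u v : C(K, ℝ)} (huv : Set.Icc u v ∈ U) {x : K} (hx : x ∈ W) : u x ≤ -1 := by
    by_contra! hux
    obtain ⟨f, hf, ⟨y, hy, hfy⟩, -⟩ := exists_mem huv
      (hWinf (isOpen_lt continuous_const u.continuous) ⟨x, hux, hx⟩)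
    exact (hy.1.trans_le (hf.1 y)).ne' hfy
  have upper {u v : C(K, ℝ)} (huv : Set.Icc u v ∈ U) {x : K} (hx : x ∈ W) : 1 ≤ v x := by
    by_contra! hvx
    obtain ⟨f, hf, -, ⟨y, hy, hfy⟩⟩ := exists_mem huv
      (hWinf (isOpen_lt v.continuous continuous_const) ⟨x, hvx, hx⟩)
    exact ((hf.2 y).trans_lt hy.1).ne hfy
  have eq_p {q : C(K, ℝ)} (hq : q ∈ Set.Icc (-1 : C(K, ℝ)) 1) (hqp : ∀ x ∉ W, q x = p x) :
      q = p := by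
    have hpS : p ∈ ⋂ q ∈ S, Set.Icc q.1 q.2 := hSp ▸ Set.mem_singleton p
    refine Set.mem_singleton_iff.1 (hSp ▸ Set.mem_iInter₂.2 fun r hr => ?_)
    have hpr := Set.mem_iInter₂.1 hpS r hr
    refine ⟨fun x => ?_, fun x => ?_⟩ <;> by_cases hx : x ∈ W
    · exact (lower (hSU r hr) hx).trans (hq.1 x)
    · exact (hpr.1 x).trans (hqp x hx).ge
    · exact (hq.2 x).trans (upper (hSU r hr) hx)
    · exact (hqp x hx).le.trans (hpr.2 x)
  obtain ⟨φ, hφW, hφx, hφ⟩ := exists_bounded_mem_Icc_of_closed_of_le hWo.isClosed_compl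
    (isClosed_singleton (x := x₀))
    (Set.disjoint_singleton_right.2 fun hx => hx hx₀) (show (-1 : ℝ) ≤ 1 by norm_num)
  let ψ : C(K, ℝ) := φ
  have hψ : ψ ∈ Set.Icc (-1 : C(K, ℝ)) 1 := ⟨fun x => (hφ x).1, fun x => (hφ x).2⟩
  have hψx : ψ x₀ = 1 := hφx rfl
  have hψW {x : K} (hx : x ∉ W) : ψ x = -1 := hφW hx
  have h1 : p ⊔ ψ = p := eq_p ⟨hp.1.trans le_sup_left, sup_le hp.2 hψ.2⟩ fun x hx => by
    rw [ContinuousMap.sup_apply, hψW hx]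
    exact sup_of_le_left (hp.1 x)
  have h2 : p ⊓ -ψ = p := eq_p
    ⟨le_inf hp.1 (neg_le_neg hψ.2), inf_le_left.trans hp.2⟩ fun x hx => by
      rw [ContinuousMap.inf_apply, ContinuousMap.neg_apply, hψW hx, neg_neg]
      exact inf_of_le_left (hp.2 x)
  have h1' : ψ x₀ ≤ p x₀ := sup_eq_left.1 h1 x₀
  have h2' : p x₀ ≤ -ψ x₀ := inf_eq_left.1 h2 x₀
  linarith

/-- If the unit ball of `C(K, ℝ)` is order compact, every `[-1, 1]`-valued function on the
isolated points of `K` extends continuously to `K`. -/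
theorem exists_extension_of_orderCompact_unitBall {K : Type*} [TopologicalSpace K] [T2Space K]
    (h : OrderCompact (Set.Icc (-1 : C(K, ℝ)) 1))
    (g : {x : K // IsOpen {x}} → ℝ) (hg : ∀ i, g i ∈ Set.Icc (-1 : ℝ) 1) :
    ∃ p : C(K, ℝ), ∀ i : {x : K // IsOpen {x}}, p i = g i := by
  classical
  have update_mem {q u v : C(K, ℝ)} (hq : q ∈ Set.Icc u v) {i : K} (hi : IsOpen {i}) {c : ℝ}
      (hc : c ∈ Set.Icc (u i) (v i)) :
      (⟨Function.update q i c, q.continuous.update_of_isOpen_singleton hi c⟩ : C(K, ℝ))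
        ∈ Set.Icc u v := by
    refine ⟨fun x => ?_, fun x => ?_⟩ <;> by_cases hx : x = i
    · subst hx; simpa using hc.1
    · simpa [hx] using hq.1 x
    · subst hx; simpa using hc.2
    · simpa [hx] using hq.2 x
  have hex (s : Finset {x : K // IsOpen {x}}) :
      ∃ f ∈ Set.Icc (-1 : C(K, ℝ)) 1, ∀ i ∈ s, f i = g i := by
    induction s using Finset.induction_on with
    | empty => exact ⟨-1, ⟨le_rfl, fun x => by norm_num⟩, by simp⟩
    | insert i s _ ih =>
      obtain ⟨f, hf, hfs⟩ := ih
      refine ⟨_, update_mem hf i.2 (hg i), fun k hk => ?_⟩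
      by_cases hki : k = i
      · subst hki; simp
      · simpa [Subtype.coe_injective.eq_iff, hki] using
          hfs k ((Finset.mem_insert.1 hk).resolve_left hki)
  choose F hF hFg using hex
  set U : Ultrafilter C(K, ℝ) := (Ultrafilter.of atTop).map F
  obtain ⟨p, -, S, -, hSU, hSp⟩ := h U (Ultrafilter.mem_map.2 (univ_mem' hF))
  refine ⟨p, fun i => ?_⟩
  have hpS : p ∈ ⋂ q ∈ S, Set.Icc q.1 q.2 := hSp ▸ Set.mem_singleton p
  have key : (⟨Function.update p i (g i), p.continuous.update_of_isOpen_singleton i.2 _⟩ :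
      C(K, ℝ)) ∈ ⋂ q ∈ S, Set.Icc q.1 q.2 := by
    refine Set.mem_iInter₂.2 fun r hr => update_mem (Set.mem_iInter₂.1 hpS r hr) i.2 ?_
    obtain ⟨t, hti, htr⟩ := Ultrafilter.exists_mem_of_mem_map_of_atTop (hSU r hr) i
    rw [← hFg t i hti]
    exact ⟨htr.1 i, htr.2 i⟩
  rw [hSp, Set.mem_singleton_iff] at key
  simpa using (DFunLike.congr_fun key (i : K)).symm

/-- A compact Hausdorff space is the Stone–Čech compactification of a space mapping densely into
it if all continuous `[0, 1]`-valued functions extend. -/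
theorem nonempty_homeomorph_stoneCech_of_extension {K : Type*} [TopologicalSpace K] [CompactSpace K] [T2Space K]
    {Ω : Type*} [TopologicalSpace Ω] {j : Ω → K}
    (hjc : Continuous j) (hj : DenseRange j)
    (hext : ∀ g : Ω → ℝ, Continuous g → (∀ ω, g ω ∈ Set.Icc (0 : ℝ) 1) →
      ∃ p : C(K, ℝ), ∀ ω, p (j ω) = g ω) :
    Nonempty (K ≃ₜ StoneCech Ω) := by
  have hcont : Continuous (stoneCechExtend hjc) := continuous_stoneCechExtend hjc
  have hinj : Function.Injective (stoneCechExtend hjc) := by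
    intro a b hab
    by_contra hne
    obtain ⟨f, hfa, hfb, hf⟩ := exists_continuous_zero_one_of_isClosed
      (isClosed_singleton (x := a)) (isClosed_singleton (x := b))
      (Set.disjoint_singleton.2 hne)
    obtain ⟨p, hp⟩ := hext (f ∘ stoneCechUnit) (f.continuous.comp continuous_stoneCechUnit)
      fun ω => hf _
    have hpf : p ∘ stoneCechExtend hjc = f := by
      refine stoneCech_hom_ext (p.continuous.comp hcont) f.continuous ?_
      ext ω
      simp [stoneCechExtend_stoneCechUnit, hp]
    have hfab : f a = f b := by rw [← hpf, Function.comp_apply, Function.comp_apply, hab]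
    have h0 : f a = 0 := hfa rfl
    have h1 : f b = 1 := hfb rfl
    rw [h0, h1] at hfab
    exact zero_ne_one hfab
  have hsurj : Function.Surjective (stoneCechExtend hjc) := by
    have hd : DenseRange (stoneCechExtend hjc) := by
      refine hj.mono ?_
      rintro _ ⟨ω, rfl⟩
      exact ⟨stoneCechUnit ω, stoneCechExtend_stoneCechUnit hjc ω⟩
    rw [← Set.range_eq_univ, ← (isCompact_range hcont).isClosed.closure_eq]
    exact hd.closure_range
  exact ⟨(hcont.homeoOfEquivCompactToT2 (f := Equiv.ofBijective _ ⟨hinj, hsurj⟩)).symm⟩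

/-- For a compact Hausdorff space `K`, the unit ball `[-1, 1]` of `C(K, ℝ)`
is order compact iff `K` is homeomorphic to the Stone–Čech compactification of a discrete
space. -/
theorem unitBall_CK_orderCompact_iff_stoneCech_of_discrete
    {K : Type u} [TopologicalSpace K] [CompactSpace K] [T2Space K] :
    OrderCompact (Set.Icc (-1 : C(K, ℝ)) 1) ↔
      ∃ (Ω : Type u) (_ : TopologicalSpace Ω), DiscreteTopology Ω ∧
        Nonempty (K ≃ₜ StoneCech Ω) := by
  constructor
  · intro h
    refine ⟨{x : K // IsOpen {x}}, inferInstance, ?_, ?_⟩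
    · refine discreteTopology_iff_isOpen_singleton.2 fun i => ?_
      have hi : ({i} : Set {x : K // IsOpen {x}}) = Subtype.val ⁻¹' {(i : K)} := by
        ext k
        simp [Subtype.ext_iff]
      rw [hi]
      exact i.2.preimage continuous_subtype_val
    · refine nonempty_homeomorph_stoneCech_of_extension continuous_subtype_val
        (dense_isolated_of_orderCompact_unitBall h).denseRange_val fun g _ hg =>
          exists_extension_of_orderCompact_unitBall h g fun i => ⟨?_, (hg i).2⟩
      exact (by norm_num : (-1 : ℝ) ≤ 0).trans (hg i).1
  · rintro ⟨Ω, _, _, ⟨e⟩⟩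
    refine orderCompact_unitBall_of_extension (j := e.symm ∘ stoneCechUnit)
      (e.symm.surjective.denseRange.comp denseRange_stoneCechUnit e.symm.continuous)
      fun g hg => ?_
    have hgc : Continuous fun ω => (⟨g ω, hg ω⟩ : Set.Icc (-1 : ℝ) 1) :=
      continuous_of_discreteTopology
    refine ⟨⟨fun x => (stoneCechExtend hgc (e x) : Set.Icc (-1 : ℝ) 1),
      continuous_subtype_val.comp ((continuous_stoneCechExtend hgc).comp e.continuous)⟩,
      fun ω => ?_⟩
    simp [stoneCechExtend_stoneCechUnit]
end
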